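/- arXiv:2603.08939 — 2 statements merged into one kernel-verified Lean document; each statement's English description precedes it below -/
import Mathlib

section
/- Let μ ∈ P_2(ℝ) have mean zero and not be a point mass (i.e. its quantile function Q_μ is not almost everywhere constant). Then ∫_0^1 u Q_μ(u) du > 0, and consequently the point mass δ_0 is not a minimizer of ν ↦ W_2(ν, μ) over F_lc. More generally, if μ ∈ P_2(ℝ) is not a point mass, then proj_{F_lc} μ is not a point mass and is absolutely continuous with respect to Lebesgue measure. -/
open MeasureTheory Set Filter

noncomputable def quantile (μ : MeasureTheory.Measure ℝ) (u : ℝ) : ℝ :=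
  sInf {x : ℝ | u ≤ (μ (Set.Iic x)).toReal}

def HasFiniteMomentP (p : ℝ) (μ : MeasureTheory.Measure ℝ) : Prop :=
  MeasureTheory.IsProbabilityMeasure μ ∧
    MeasureTheory.Integrable (fun x => |x| ^ p) μ

noncomputable def Wdist (p : ℝ) (μ ν : MeasureTheory.Measure ℝ) : ℝ :=
  (∫ u in Set.Ioo (0:ℝ) 1, |quantile μ u - quantile ν u| ^ p) ^ (1 / p)

def DisplacementConvex (F : Set (MeasureTheory.Measure ℝ)) : Prop :=
  ∀ μ ∈ F, ∀ ν ∈ F, ∀ t ∈ Set.Icc (0:ℝ) 1, ∃ σ ∈ F,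
    ∀ u ∈ Set.Ioo (0:ℝ) 1,
      quantile σ u = (1 - t) * quantile μ u + t * quantile ν u

def WClosed (p : ℝ) (F : Set (MeasureTheory.Measure ℝ)) : Prop :=
  ∀ (μs : ℕ → MeasureTheory.Measure ℝ) (μ : MeasureTheory.Measure ℝ),
    (∀ n, μs n ∈ F) → HasFiniteMomentP p μ →
    Filter.Tendsto (fun n => Wdist p (μs n) μ) Filter.atTop (nhds 0) → μ ∈ F

/-- A Borel probability measure on `ℝ` is log-concave if it is a point mass, or it has a
density `f` with respect to Lebesgue measure such that `log f : ℝ → [−∞, ∞)` is concave;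
the latter is expressed by the multiplicative inequality
`f((1−t)x + ty) ≥ f(x)^(1−t) · f(y)^t`. -/
def IsLogConcave (μ : MeasureTheory.Measure ℝ) : Prop :=
  (∃ x : ℝ, μ = MeasureTheory.Measure.dirac x) ∨
  ∃ f : ℝ → ℝ, (∀ x, 0 ≤ f x) ∧
    μ = MeasureTheory.volume.withDensity (fun x => ENNReal.ofReal (f x)) ∧
    ∀ x y : ℝ, ∀ t ∈ Set.Icc (0:ℝ) 1,
      f x ^ (1 - t) * f y ^ t ≤ f ((1 - t) * x + t * y)

/-- The set `F_lc` of log-concave probability measures on `ℝ`. -/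
def Flc : Set (MeasureTheory.Measure ℝ) :=
  {μ | MeasureTheory.IsProbabilityMeasure μ ∧ IsLogConcave μ}

theorem quantile_le_iff (μ : Measure ℝ) [IsProbabilityMeasure μ] {u : ℝ}
    (hu : u ∈ Ioo (0 : ℝ) 1) (x : ℝ) :
    quantile μ u ≤ x ↔ u ≤ (μ (Iic x)).toReal := by
  have hcdf : ∀ y, (μ (Iic y)).toReal = ProbabilityTheory.cdf μ y := fun y =>
    (ProbabilityTheory.cdf_eq_real μ y).symm
  have hmono := ProbabilityTheory.monotone_cdf μ
  have hbdd : BddBelow {x : ℝ | u ≤ (μ (Iic x)).toReal} := by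
    obtain ⟨y, hy⟩ := ((ProbabilityTheory.tendsto_cdf_atBot μ).eventually_lt_const hu.1).exists
    refine ⟨y, fun z hz => ?_⟩
    by_contra! h
    rw [mem_ofPred_eq, hcdf] at hz
    exact absurd (hz.trans (hmono h.le)) (not_le.2 hy)
  have hne : {x : ℝ | u ≤ (μ (Iic x)).toReal}.Nonempty := by
    obtain ⟨y, hy⟩ := ((ProbabilityTheory.tendsto_cdf_atTop μ).eventually_const_lt hu.2).exists
    exact ⟨y, by rw [mem_ofPred_eq, hcdf]; exact hy.le⟩
  refine ⟨fun h => ?_, fun h => csInf_le hbdd h⟩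
  by_contra! hlt
  rw [hcdf] at hlt
  have hright := ((ProbabilityTheory.cdf μ).right_continuous x).mono Ioi_subset_Ici_self
  obtain ⟨y, hy, hxy⟩ :=
    ((hright.tendsto.eventually_lt_const hlt).and self_mem_nhdsWithin).exists
  have hle : y ≤ quantile μ u := by
    refine le_csInf hne fun z hz => ?_
    by_contra! h
    rw [mem_ofPred_eq, hcdf] at hz
    exact absurd (hz.trans (hmono h.le)) (not_le.2 hy)
  exact absurd (hle.trans h) (not_le.2 hxy)

theorem monotoneOn_quantile (μ : Measure ℝ) [IsProbabilityMeasure μ] :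
    MonotoneOn (quantile μ) (Ioo 0 1) := fun _ hu _ hv huv =>
  (quantile_le_iff μ hu _).2 (huv.trans ((quantile_le_iff μ hv _).1 le_rfl))

theorem aemeasurable_quantile (μ : Measure ℝ) [IsProbabilityMeasure μ] :
    AEMeasurable (quantile μ) (volume.restrict (Ioo 0 1)) :=
  aemeasurable_restrict_of_monotoneOn measurableSet_Ioo (monotoneOn_quantile μ)

instance isProbabilityMeasure_volume_Ioo_zero_one :
    IsProbabilityMeasure (volume.restrict (Ioo (0 : ℝ) 1)) :=
  ⟨by simp⟩

theorem map_quantile (μ : Measure ℝ) [IsProbabilityMeasure μ] :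
    (volume.restrict (Ioo 0 1)).map (quantile μ) = μ := by
  have hprob := Measure.isProbabilityMeasure_map (aemeasurable_quantile μ)
  refine Measure.ext_of_Iic _ _ fun x => ?_
  rw [Measure.map_apply_of_aemeasurable (aemeasurable_quantile μ) measurableSet_Iic,
    Measure.restrict_apply' measurableSet_Ioo, ← ENNReal.ofReal_toReal (measure_ne_top μ (Iic x))]
  have hset : quantile μ ⁻¹' Iic x ∩ Ioo 0 1 = Iic (μ (Iic x)).toReal ∩ Ioo 0 1 := by
    ext u
    exact and_congr_left fun hu => quantile_le_iff μ hu x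
  have hle : (μ (Iic x)).toReal ≤ 1 := measureReal_le_one
  rw [hset]
  refine le_antisymm ?_ ?_
  · calc volume (Iic (μ (Iic x)).toReal ∩ Ioo 0 1) ≤ volume (Ioc 0 (μ (Iic x)).toReal) :=
        measure_mono fun u hu => ⟨hu.2.1, hu.1⟩
      _ = _ := by rw [Real.volume_Ioc, sub_zero]
  · calc ENNReal.ofReal (μ (Iic x)).toReal = volume (Ioo 0 (μ (Iic x)).toReal) := by
          rw [Real.volume_Ioo, sub_zero]
      _ ≤ volume (Iic (μ (Iic x)).toReal ∩ Ioo 0 1) :=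
        measure_mono fun u hu => ⟨hu.2.le, hu.1, hu.2.trans_le hle⟩

theorem quantile_eq_of_forall_le_iff {μ : Measure ℝ} {u c : ℝ}
    (h : ∀ x, u ≤ (μ (Iic x)).toReal ↔ c ≤ x) : quantile μ u = c := by
  have hset : {x : ℝ | u ≤ (μ (Iic x)).toReal} = Ici c := by
    ext x
    exact h x
  rw [quantile, hset, csInf_Ici]

theorem quantile_dirac (c : ℝ) {u : ℝ} (hu : u ∈ Ioo (0 : ℝ) 1) :
    quantile (Measure.dirac c) u = c := by
  refine quantile_eq_of_forall_le_iff fun x => ?_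
  rw [Measure.dirac_apply' _ measurableSet_Iic]
  by_cases h : c ≤ x
  · simp [h, hu.2.le]
  · simp [h, hu.1]

/-- The uniform distribution on `[a, a + r]`. -/
noncomputable def uniformIcc (a r : ℝ) : Measure ℝ :=
  volume.withDensity fun x => ENNReal.ofReal ((Icc a (a + r)).indicator (fun _ => r⁻¹) x)

theorem ofReal_indicator_Icc_inv (a r : ℝ) :
    (fun x => ENNReal.ofReal ((Icc a (a + r)).indicator (fun _ => r⁻¹) x)) =
      (Icc a (a + r)).indicator fun _ => ENNReal.ofReal r⁻¹ := by
  ext x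
  by_cases h : x ∈ Icc a (a + r) <;> simp [h]

theorem uniformIcc_Iic_toReal (a : ℝ) {r : ℝ} (hr : 0 < r) (x : ℝ) :
    (uniformIcc a r (Iic x)).toReal = r⁻¹ * max (min (a + r) x - a) 0 := by
  have hinter : Icc a (a + r) ∩ Iic x = Icc a (min (a + r) x) := by
    ext y
    simp [and_assoc]
  rw [uniformIcc, ofReal_indicator_Icc_inv, withDensity_apply _ measurableSet_Iic,
    lintegral_indicator_const measurableSet_Icc, Measure.restrict_apply measurableSet_Icc,
    hinter, Real.volume_Icc, ENNReal.toReal_mul, ENNReal.toReal_ofReal (by positivity),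
    ENNReal.toReal_ofReal']

theorem quantile_uniformIcc (a : ℝ) {r u : ℝ} (hr : 0 < r) (hu : u ∈ Ioo (0 : ℝ) 1) :
    quantile (uniformIcc a r) u = a + r * u := by
  refine quantile_eq_of_forall_le_iff fun x => ?_
  have h1 := mul_pos hr hu.1
  have h2 := mul_lt_of_lt_one_right hr hu.2
  rw [uniformIcc_Iic_toReal a hr, le_inv_mul_iff₀ hr]
  constructor
  · intro h
    rcases le_max_iff.1 h with h | h
    · linarith [min_le_right (a + r) x]
    · linarith
  · intro h
    exact le_max_of_le_left (le_sub_iff_add_le'.2 (le_min (by linarith) h))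

theorem uniformIcc_mem_Flc (a : ℝ) {r : ℝ} (hr : 0 < r) : uniformIcc a r ∈ Flc := by
  refine ⟨⟨?_⟩, Or.inr ⟨(Icc a (a + r)).indicator fun _ => r⁻¹, fun x => ?_, rfl, ?_⟩⟩
  · rw [uniformIcc, withDensity_apply _ MeasurableSet.univ, Measure.restrict_univ]
    rw [ofReal_indicator_Icc_inv, lintegral_indicator_const measurableSet_Icc, Real.volume_Icc,
      ← ENNReal.ofReal_mul (by positivity), add_sub_cancel_left, inv_mul_cancel₀ hr.ne',
      ENNReal.ofReal_one]
  · exact indicator_nonneg (fun _ _ => by positivity) x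
  · intro x y t ht
    have hr' : (0 : ℝ) < r⁻¹ := by positivity
    have hnn : 0 ≤ (Icc a (a + r)).indicator (fun _ => r⁻¹) ((1 - t) * x + t * y) :=
      indicator_nonneg (fun _ _ => hr'.le) _
    rcases ht.1.eq_or_lt with rfl | h0
    · simp
    rcases ht.2.eq_or_lt with rfl | h1
    · simp
    by_cases hx : x ∈ Icc a (a + r)
    · by_cases hy : y ∈ Icc a (a + r)
      · have hxy : (1 - t) * x + t * y ∈ Icc a (a + r) :=
          convex_Icc a (a + r) hx hy (by linarith) h0.le (by ring)
        rw [indicator_of_mem hx, indicator_of_mem hy, indicator_of_mem hxy, ← Real.rpow_add hr']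
        simp
      · rw [indicator_of_notMem hy, Real.zero_rpow h0.ne', mul_zero]
        exact hnn
    · rw [indicator_of_notMem hx, Real.zero_rpow (by linarith), zero_mul]
      exact hnn

theorem memLp_two_quantile {μ : Measure ℝ} (hμ : HasFiniteMomentP 2 μ) :
    MemLp (quantile μ) 2 (volume.restrict (Ioo 0 1)) := by
  have := hμ.1
  have hid : MemLp (fun x : ℝ => x) 2 μ := by
    refine (memLp_two_iff_integrable_sq measurable_id.aestronglyMeasurable).2 ?_
    simpa using hμ.2
  rw [← map_quantile μ] at hid
  exact hid.comp_of_map (aemeasurable_quantile μ)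

theorem integral_quantile (μ : Measure ℝ) [IsProbabilityMeasure μ] :
    ∫ u in Ioo (0 : ℝ) 1, quantile μ u = ∫ x, x ∂μ := by
  conv_rhs => rw [← map_quantile μ]
  exact (integral_map (aemeasurable_quantile μ) measurable_id.aestronglyMeasurable).symm

theorem memLp_sub_half : MemLp (fun u : ℝ => u - 1 / 2) 2 (volume.restrict (Ioo 0 1)) := by
  refine MemLp.of_bound (by fun_prop) 1 ?_
  filter_upwards [ae_restrict_mem measurableSet_Ioo] with u hu
  rw [Real.norm_eq_abs, abs_le]
  constructor <;> linarith [hu.1, hu.2]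

theorem integrable_sub_half_mul_quantile {μ : Measure ℝ} (hμ : HasFiniteMomentP 2 μ) :
    Integrable (fun u => (u - 1 / 2) * quantile μ u) (volume.restrict (Ioo 0 1)) :=
  memLp_sub_half.integrable_mul (memLp_two_quantile hμ)

theorem integral_sub_half : ∫ u in Ioo (0 : ℝ) 1, (u - 1 / 2) = 0 := by
  rw [← integral_Ioc_eq_integral_Ioo, ← intervalIntegral.integral_of_le zero_le_one]
  rw [intervalIntegral.integral_sub (by simp) (by simp), integral_id]
  norm_num

theorem integral_sub_half_sq : ∫ u in Ioo (0 : ℝ) 1, (u - 1 / 2) ^ 2 = 1 / 12 := by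
  rw [← integral_Ioc_eq_integral_Ioo, ← intervalIntegral.integral_of_le zero_le_one,
    intervalIntegral.integral_comp_sub_right (fun u => u ^ 2), integral_pow]
  norm_num

theorem integral_sub_half_mul_quantile_pos {μ : Measure ℝ} (hμ : HasFiniteMomentP 2 μ)
    (hnpm : ¬ ∃ x : ℝ, μ = Measure.dirac x) :
    0 < ∫ u in Ioo (0 : ℝ) 1, (u - 1 / 2) * quantile μ u := by
  have := hμ.1
  set q := quantile μ (1 / 2) with hq
  have hhalf : (1 / 2 : ℝ) ∈ Ioo (0 : ℝ) 1 := by constructor <;> norm_num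
  have hint := integrable_sub_half_mul_quantile hμ
  have hint' : Integrable (fun u : ℝ => (u - 1 / 2) * q) (volume.restrict (Ioo 0 1)) :=
    (memLp_sub_half.integrable one_le_two).mul_const q
  have hcenter : ∫ u in Ioo (0 : ℝ) 1, (u - 1 / 2) * (quantile μ u - q) =
      ∫ u in Ioo (0 : ℝ) 1, (u - 1 / 2) * quantile μ u := by
    simp_rw [mul_sub (_ - _)]
    rw [integral_sub hint hint', integral_mul_const, integral_sub_half, zero_mul, sub_zero]
  have hnonneg : 0 ≤ᵐ[volume.restrict (Ioo 0 1)]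
      fun u => (u - 1 / 2) * (quantile μ u - q) := by
    filter_upwards [ae_restrict_mem measurableSet_Ioo] with u hu
    rcases le_total u (1 / 2) with h | h
    · exact mul_nonneg_of_nonpos_of_nonpos (by linarith)
        (sub_nonpos.2 (monotoneOn_quantile μ hu hhalf h))
    · exact mul_nonneg (by linarith) (sub_nonneg.2 (monotoneOn_quantile μ hhalf hu h))
  have hintegrable : Integrable (fun u => (u - 1 / 2) * (quantile μ u - q))
      (volume.restrict (Ioo 0 1)) := by
    simp_rw [mul_sub (_ - _)]
    exact hint.sub hint'
  rw [← hcenter]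
  refine (integral_nonneg_of_ae hnonneg).lt_of_ne fun h0 => hnpm ⟨q, ?_⟩
  have hzero := (integral_eq_zero_iff_of_nonneg_ae hnonneg hintegrable).1 h0.symm
  have hconst : quantile μ =ᵐ[volume.restrict (Ioo 0 1)] fun _ => q := by
    filter_upwards [hzero] with u hu
    rcases mul_eq_zero.1 hu with h | h
    · rw [sub_eq_zero.1 h]
    · exact sub_eq_zero.1 h
  rw [← map_quantile μ, Measure.map_congr hconst, Measure.map_const]
  simp

theorem exists_mem_Flc_Wdist_lt_dirac {μ : Measure ℝ} (hμ : HasFiniteMomentP 2 μ)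
    (hnpm : ¬ ∃ x : ℝ, μ = Measure.dirac x) (c : ℝ) :
    ∃ ν ∈ Flc, Wdist 2 ν μ < Wdist 2 (Measure.dirac c) μ := by
  have := hμ.1
  have hpos := integral_sub_half_mul_quantile_pos hμ hnpm
  set r := ∫ u in Ioo (0 : ℝ) 1, (u - 1 / 2) * quantile μ u with hr
  refine ⟨uniformIcc (c - r / 2) r, uniformIcc_mem_Flc _ hpos, ?_⟩
  have hQ := memLp_two_quantile hμ
  have hdirac : ∫ u in Ioo (0 : ℝ) 1, |quantile (Measure.dirac c) u - quantile μ u| ^ (2 : ℝ) =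
      ∫ u in Ioo (0 : ℝ) 1, (c - quantile μ u) ^ 2 :=
    setIntegral_congr_fun measurableSet_Ioo fun u hu => by simp [quantile_dirac c hu]
  have hI1 : Integrable (fun u => (c - quantile μ u) ^ 2) (volume.restrict (Ioo 0 1)) :=
    ((memLp_const c).sub hQ).integrable_sq
  have hI2 : Integrable (fun u => 2 * r * c * (u - 1 / 2)) (volume.restrict (Ioo 0 1)) :=
    (memLp_sub_half.integrable one_le_two).const_mul _
  have hI3 : Integrable (fun u => 2 * r * ((u - 1 / 2) * quantile μ u))
      (volume.restrict (Ioo 0 1)) :=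
    (integrable_sub_half_mul_quantile hμ).const_mul _
  have hI4 : Integrable (fun u : ℝ => r ^ 2 * (u - 1 / 2) ^ 2) (volume.restrict (Ioo 0 1)) :=
    memLp_sub_half.integrable_sq.const_mul _
  have hunif : ∫ u in Ioo (0 : ℝ) 1,
        |quantile (uniformIcc (c - r / 2) r) u - quantile μ u| ^ (2 : ℝ) =
      (∫ u in Ioo (0 : ℝ) 1, (c - quantile μ u) ^ 2) - 23 / 12 * r ^ 2 := by
    calc _ = ∫ u in Ioo (0 : ℝ) 1, ((c - quantile μ u) ^ 2 + 2 * r * c * (u - 1 / 2)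
            - 2 * r * ((u - 1 / 2) * quantile μ u) + r ^ 2 * (u - 1 / 2) ^ 2) := by
          refine setIntegral_congr_fun measurableSet_Ioo fun u hu => ?_
          simp only [quantile_uniformIcc _ hpos hu, Real.rpow_two, sq_abs]
          ring
      _ = _ := by
          rw [integral_add (by exact (hI1.add hI2).sub hI3) hI4,
            integral_sub (by exact hI1.add hI2) hI3,
            integral_add hI1 hI2, integral_const_mul, integral_const_mul, integral_const_mul,
            integral_sub_half, integral_sub_half_sq, ← hr]
          ring
  have hnn : 0 ≤ ∫ u in Ioo (0 : ℝ) 1,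
      |quantile (uniformIcc (c - r / 2) r) u - quantile μ u| ^ (2 : ℝ) :=
    integral_nonneg fun u => by positivity
  rw [Wdist, Wdist]
  refine Real.rpow_lt_rpow hnn ?_ (by norm_num)
  rw [hunif, hdirac]
  have := sq_pos_of_pos hpos
  linarith

/-- Proposition 4.6(i). If `μ ∈ P_2(ℝ)` is not a point mass, then:
(a) if `μ` has mean zero, `∫_0^1 u Q_μ(u) du > 0`;
(b) consequently, if `μ` has mean zero, `δ_0` is not a minimizer of `ν ↦ W_2(ν, μ)`
over `F_lc`;
(c) more generally, the projection `proj_{F_lc} μ` (any minimizer of `ν ↦ W_2(ν, μ)`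
over `F_lc`) is not a point mass and is absolutely continuous with respect to Lebesgue
measure. -/
theorem wasserstein_projection_logConcave_not_point_mass
    (μ : MeasureTheory.Measure ℝ) (hμ : HasFiniteMomentP 2 μ)
    (hnpm : ¬ ∃ x : ℝ, μ = MeasureTheory.Measure.dirac x) :
    ((∫ x, x ∂μ) = 0 →
        0 < ∫ u in Set.Ioo (0:ℝ) 1, u * quantile μ u) ∧
    ((∫ x, x ∂μ) = 0 →
        ∃ ν ∈ Flc, Wdist 2 ν μ < Wdist 2 (MeasureTheory.Measure.dirac 0) μ) ∧
    (∀ μhat : MeasureTheory.Measure ℝ, μhat ∈ Flc →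
        (∀ ν ∈ Flc, Wdist 2 μhat μ ≤ Wdist 2 ν μ) →
        (¬ ∃ x : ℝ, μhat = MeasureTheory.Measure.dirac x) ∧
          μhat ≪ MeasureTheory.volume) := by
  have hprob := hμ.1
  refine ⟨fun hmean => ?_, fun _ => exists_mem_Flc_Wdist_lt_dirac hμ hnpm 0,
    fun μhat hmem hmin => ?_⟩
  · have hpos := integral_sub_half_mul_quantile_pos hμ hnpm
    have hQ := memLp_two_quantile hμ
    have hsplit : ∫ u in Ioo (0 : ℝ) 1, u * quantile μ u =
        ∫ u in Ioo (0 : ℝ) 1, ((u - 1 / 2) * quantile μ u + 1 / 2 * quantile μ u) :=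
      integral_congr_ae (ae_of_all _ fun u => by ring)
    rw [hsplit, integral_add (integrable_sub_half_mul_quantile hμ)
      ((hQ.integrable one_le_two).const_mul _), integral_const_mul, integral_quantile, hmean]
    simpa using hpos
  · have hnot : ¬ ∃ x : ℝ, μhat = Measure.dirac x := by
      rintro ⟨c, rfl⟩
      obtain ⟨ν, hν, hlt⟩ := exists_mem_Flc_Wdist_lt_dirac hμ hnpm c
      exact absurd (hmin ν hν) (not_le.2 hlt)
    refine ⟨hnot, ?_⟩
    rcases hmem.2 with h | ⟨f, -, rfl, -⟩
    · exact absurd h hnot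
    · exact withDensity_absolutelyContinuous _ _
end

section
/- Let μ be a non-degenerate log-concave probability measure on ℝ (i.e. μ ∈ F_lc and μ is not a point mass), with density f, quantile function Q_μ, and h := 1/Q_μ' (which is positive and concave on (0,1)). Then f is piecewise log-affine with finitely many pieces if and only if h is piecewise affine on (0,1) with finitely many pieces. -/
open MeasureTheory Set Filter

section LogConcaveDensity

variable {f : ℝ → ℝ}

theorem convex_setOf_pos_of_mul_rpow_le
    (hf : ∀ y z : ℝ, ∀ t ∈ Icc (0:ℝ) 1, f y ^ (1 - t) * f z ^ t ≤ f ((1 - t) * y + t * z)) :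
    Convex ℝ {z : ℝ | 0 < f z} := by
  intro y hy z hz a b ha hb hab
  obtain rfl : a = 1 - b := by linarith
  exact (mul_pos (Real.rpow_pos_of_pos hy _) (Real.rpow_pos_of_pos hz _)).trans_le
    (hf y z b ⟨hb, by linarith⟩)

theorem continuousOn_interior_setOf_pos_of_mul_rpow_le
    (hf : ∀ y z : ℝ, ∀ t ∈ Icc (0:ℝ) 1, f y ^ (1 - t) * f z ^ t ≤ f ((1 - t) * y + t * z)) :
    ContinuousOn f (interior {z : ℝ | 0 < f z}) := by
  have hlog : ConcaveOn ℝ {z : ℝ | 0 < f z} (fun z => Real.log (f z)) := by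
    refine ⟨convex_setOf_pos_of_mul_rpow_le hf, fun y hy z hz a b ha hb hab => ?_⟩
    obtain rfl : a = 1 - b := by linarith
    have hy' : 0 < f y := hy
    have hz' : 0 < f z := hz
    have key := Real.log_le_log
      (mul_pos (Real.rpow_pos_of_pos hy' (1 - b)) (Real.rpow_pos_of_pos hz' b))
      (hf y z b ⟨hb, by linarith⟩)
    rw [Real.log_mul (Real.rpow_pos_of_pos hy' _).ne' (Real.rpow_pos_of_pos hz' _).ne',
      Real.log_rpow hy', Real.log_rpow hz'] at key
    exact key
  refine (Real.continuous_exp.comp_continuousOn hlog.continuousOn_interior).congr fun z hz => ?_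
  have hfz : z ∈ {z : ℝ | 0 < f z} := interior_subset hz
  exact (Real.exp_log hfz).symm

end LogConcaveDensity

section DistributionFunction

variable {μ : Measure ℝ} {f : ℝ → ℝ}

theorem hasDerivAt_measureReal_Iic_of_withDensity [IsFiniteMeasure μ] (hf0 : ∀ y, 0 ≤ f y)
    (hfd : μ = volume.withDensity (fun y => ENNReal.ofReal (f y)))
    {U : Set ℝ} (hU : IsOpen U) (hfU : ContinuousOn f U) {y : ℝ} (hy : y ∈ U) :
    HasDerivAt (fun x => μ.real (Iic x)) (f y) y := by
  obtain ⟨r, hr, hrU⟩ := Metric.isOpen_iff.1 hU y hy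
  rw [Real.ball_eq_Ioo] at hrU
  set a := y - r / 2
  have hay : a < y := by simp only [a]; linarith
  have hIcc : ∀ z, z < y + r → Icc a z ⊆ U := fun z hz x hx =>
    hrU ⟨by have := hx.1; simp only [a] at this; linarith, hx.2.trans_lt hz⟩
  have hint : IntervalIntegrable f volume a y :=
    (hfU.mono (by rw [uIcc_of_le hay.le]; exact hIcc y (by linarith))).intervalIntegrable
  have hFTC : HasDerivAt (fun z => ∫ x in a..z, f x) (f y) y :=
    intervalIntegral.integral_hasDerivAt_right hint
      (hfU.stronglyMeasurableAtFilter hU y hy) (hfU.continuousAt (hU.mem_nhds hy))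
  refine (hFTC.const_add (μ.real (Iic a))).congr_of_eventuallyEq ?_
  filter_upwards [Ioo_mem_nhds hay (by linarith : y < y + r)] with z hz
  have hmeas : μ.real (Ioc a z) = ∫ x in a..z, f x := by
    rw [intervalIntegral.integral_of_le hz.1.le,
      integral_eq_lintegral_of_nonneg_ae (Eventually.of_forall hf0)
        ((hfU.mono (Ioc_subset_Icc_self.trans (hIcc z hz.2))).aestronglyMeasurable
          measurableSet_Ioc), Measure.real, hfd, withDensity_apply _ measurableSet_Ioc]
  rw [← hmeas, ← measureReal_union (Set.Iic_disjoint_Ioc le_rfl) measurableSet_Ioc,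
    Iic_union_Ioc_eq_Iic hz.1.le]

theorem monotone_measureReal_Iic [IsFiniteMeasure μ] : Monotone fun x => μ.real (Iic x) :=
  fun _ _ hxy => measureReal_mono (Iic_subset_Iic.2 hxy)

theorem measureReal_Iic_lt_of_hasDerivAt_pos [IsFiniteMeasure μ] {x y d : ℝ} (hd : 0 < d)
    (hy : HasDerivAt (fun x => μ.real (Iic x)) d y) (hxy : x < y) :
    μ.real (Iic x) < μ.real (Iic y) := by
  by_contra! hle
  have heq : ∀ z ∈ Ioc x y, μ.real (Iic z) = μ.real (Iic y) := fun z hz =>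
    le_antisymm (monotone_measureReal_Iic hz.2) (hle.trans (monotone_measureReal_Iic hz.1.le))
  have h1 : HasDerivWithinAt (fun x => μ.real (Iic x)) 0 (Iic y) y := by
    refine (hasDerivWithinAt_const y (Iic y) (μ.real (Iic y))).congr_of_eventuallyEq ?_ rfl
    filter_upwards [Ioc_mem_nhdsLE hxy] with z hz using heq z hz
  exact hd.ne ((uniqueDiffWithinAt_Iic y).eq_deriv _ h1 hy.hasDerivWithinAt)

theorem quantile_measureReal_Iic [IsFiniteMeasure μ] {y d : ℝ} (hd : 0 < d)
    (hy : HasDerivAt (fun x => μ.real (Iic x)) d y) : quantile μ (μ.real (Iic y)) = y := by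
  refine IsLeast.csInf_eq ⟨le_refl (μ.real (Iic y)), fun x hx => ?_⟩
  by_contra! hlt
  exact (measureReal_Iic_lt_of_hasDerivAt_pos hd hy hlt).not_ge hx

theorem measureReal_Iic_quantile [IsProbabilityMeasure μ] [NullSingletonClass μ] {u : ℝ}
    (hu : u ∈ Ioo (0:ℝ) 1) : μ.real (Iic (quantile μ u)) = u := by
  have hcdf : (fun x => μ.real (Iic x)) = ProbabilityTheory.cdf μ :=
    funext fun x => (ProbabilityTheory.cdf_eq_real μ x).symm
  have hcont : Continuous fun x => μ.real (Iic x) := by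
    rw [hcdf, continuous_iff_continuousAt]
    intro x
    rw [(ProbabilityTheory.monotone_cdf μ).continuousAt_iff_leftLim_eq_rightLim,
      StieltjesFunction.rightLim_eq]
    have h0 := (ProbabilityTheory.cdf μ).measure_singleton x
    rw [ProbabilityTheory.measure_cdf, measure_singleton, eq_comm, ENNReal.ofReal_eq_zero] at h0
    exact le_antisymm ((ProbabilityTheory.monotone_cdf μ).leftLim_le le_rfl) (by linarith)
  have hbot : Tendsto (fun x => μ.real (Iic x)) atBot (nhds 0) :=
    hcdf ▸ ProbabilityTheory.tendsto_cdf_atBot μ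
  have htop : Tendsto (fun x => μ.real (Iic x)) atTop (nhds 1) :=
    hcdf ▸ ProbabilityTheory.tendsto_cdf_atTop μ
  obtain ⟨b, hb⟩ := (htop.eventually (lt_mem_nhds hu.2)).exists
  obtain ⟨a, ha⟩ := (hbot.eventually (gt_mem_nhds hu.1)).exists
  set S := {x : ℝ | u ≤ μ.real (Iic x)}
  have hbdd : BddBelow S := ⟨a, fun x hx => by
    by_contra! hlt
    exact (hx.trans (monotone_measureReal_Iic hlt.le)).not_gt ha⟩
  have hmem : quantile μ u ∈ S :=
    (isClosed_le continuous_const hcont).csInf_mem ⟨b, hb.le⟩ hbdd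
  refine le_antisymm ?_ hmem
  refine le_of_tendsto (hcont.continuousWithinAt (s := Iio (quantile μ u))) ?_
  filter_upwards [self_mem_nhdsWithin] with x hx
  exact (not_le.1 fun hux => (csInf_le hbdd hux).not_gt hx).le

theorem quantile_mem_interior_setOf_pos [IsProbabilityMeasure μ] [NullSingletonClass μ]
    (hfd : μ = volume.withDensity (fun y => ENNReal.ofReal (f y)))
    (hconv : Convex ℝ {z : ℝ | 0 < f z}) {u : ℝ} (hu : u ∈ Ioo (0:ℝ) 1) :
    quantile μ u ∈ interior {z : ℝ | 0 < f z} := by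
  have hpos : ∀ s, MeasurableSet s → μ s ≠ 0 → ∃ x ∈ s, 0 < f x := by
    intro s hs hμ
    by_contra! hle
    refine hμ ?_
    rw [hfd, withDensity_apply _ hs]
    exact (setLIntegral_congr_fun hs fun x hx => ENNReal.ofReal_eq_zero.2 (hle x hx)).trans
      lintegral_zero
  have hq := measureReal_Iic_quantile (μ := μ) hu
  obtain ⟨x, hx, hfx⟩ := hpos (Iio (quantile μ u)) measurableSet_Iio fun h0 => by
    rw [measure_congr Iio_ae_eq_Iic] at h0
    simp only [Measure.real, h0, ENNReal.toReal_zero] at hq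
    exact hu.1.ne hq
  obtain ⟨z, hz, hfz⟩ := hpos (Ioi (quantile μ u)) measurableSet_Ioi fun h0 => by
    have hc := probReal_compl_eq_one_sub (μ := μ) (measurableSet_Iic (a := quantile μ u))
    rw [compl_Iic, hq, Measure.real, h0, ENNReal.toReal_zero] at hc
    linarith [hu.2]
  exact mem_interior_iff_mem_nhds.2 (mem_of_superset (Icc_mem_nhds hx hz)
    (hconv.ordConnected.out hfx hfz))

end DistributionFunction

theorem eq_center_of_hasDerivAt_zero_on_ball {g : ℝ → ℝ} {y r : ℝ}
    (hg : ∀ z ∈ Metric.ball y r, HasDerivAt g 0 z) {z : ℝ} (hz : z ∈ Metric.ball y r) :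
    g z = g y := by
  have hy : y ∈ Metric.ball y r := Metric.mem_ball_self (Metric.pos_of_mem_ball hz)
  exact (convex_ball y r).is_const_of_fderivWithin_eq_zero (𝕜 := ℝ)
    (fun x hx => (hg x hx).differentiableAt.differentiableWithinAt)
    (fun x hx => by
      rw [fderivWithin_of_isOpen Metric.isOpen_ball hx]
      simpa using (hg x hx).hasFDerivAt.fderiv) hz hy

/-- Lemma 4.8. Let `μ` be a non-degenerate log-concave probability
measure on `ℝ` with density `f` and quantile function `Q = quantile μ`, and let
`h = 1/Q'` (so `Q' = 1/h` on `(0,1)`, with `h` positive and concave on `(0,1)`). Then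
`f` is piecewise log-affine with finitely many pieces (i.e. away from a finite set of
break points, `f = exp(affine)` locally on the interior of `{f > 0}`) if and only if
`h` is piecewise affine on `(0,1)` with finitely many pieces (i.e. away from a finite
set of break points, `h` is locally affine on `(0,1)`). -/
theorem piecewise_logaffine_density_iff_piecewise_affine_h
    (μ : MeasureTheory.Measure ℝ) [MeasureTheory.IsProbabilityMeasure μ]
    (hnpm : ¬ ∃ x : ℝ, μ = MeasureTheory.Measure.dirac x)
    (f : ℝ → ℝ) (hf0 : ∀ y, 0 ≤ f y)
    (hfd : μ = MeasureTheory.volume.withDensity (fun y => ENNReal.ofReal (f y)))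
    (hflc : ∀ y z : ℝ, ∀ t ∈ Set.Icc (0:ℝ) 1,
      f y ^ (1 - t) * f z ^ t ≤ f ((1 - t) * y + t * z))
    (h : ℝ → ℝ)
    (hpos : ∀ u ∈ Set.Ioo (0:ℝ) 1, 0 < h u)
    (hconc : ConcaveOn ℝ (Set.Ioo (0:ℝ) 1) h)
    (hderiv : ∀ u ∈ Set.Ioo (0:ℝ) 1, HasDerivAt (quantile μ) (h u)⁻¹ u) :
    (∃ s : Finset ℝ,
        ∀ y ∈ interior {z : ℝ | 0 < f z}, y ∉ s →
          ∃ ε > 0, ∃ α β : ℝ, ∀ z : ℝ, |z - y| < ε → f z = Real.exp (α + β * z)) ↔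
    (∃ s : Finset ℝ,
        ∀ u ∈ Set.Ioo (0:ℝ) 1, u ∉ s →
          ∃ ε > 0, ∃ α β : ℝ, ∀ v : ℝ, |v - u| < ε → h v = α + β * v) := by
  have hac : μ ≪ volume := hfd ▸ withDensity_absolutelyContinuous _ _
  have : NullSingletonClass μ := ⟨fun x => hac (measure_singleton x)⟩
  set J := interior {z : ℝ | 0 < f z}
  set F : ℝ → ℝ := fun x => μ.real (Iic x)
  have hJ : IsOpen J := isOpen_interior
  have hfJ : ∀ y ∈ J, 0 < f y := fun y hy => (interior_subset hy : y ∈ {z : ℝ | 0 < f z})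
  have hF : ∀ y ∈ J, HasDerivAt F (f y) y := fun y hy =>
    hasDerivAt_measureReal_Iic_of_withDensity hf0 hfd hJ
      (continuousOn_interior_setOf_pos_of_mul_rpow_le hflc) hy
  have hQF : ∀ y ∈ J, quantile μ (F y) = y := fun y hy =>
    quantile_measureReal_Iic (hfJ y hy) (hF y hy)
  have hF01 : ∀ y ∈ J, F y ∈ Ioo (0:ℝ) 1 := by
    intro y hy
    obtain ⟨b, hb, hyb⟩ :=
      ((eventually_nhdsWithin_of_eventually_nhds (hJ.mem_nhds hy)).and
        (self_mem_nhdsWithin (s := Ioi y))).exists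
    exact ⟨measureReal_nonneg.trans_lt
        (measureReal_Iic_lt_of_hasDerivAt_pos (hfJ y hy) (hF y hy) (sub_one_lt y)),
      (measureReal_Iic_lt_of_hasDerivAt_pos (hfJ b hb) (hF b hb) hyb).trans_le
        measureReal_le_one⟩
  have hFQ : ∀ u ∈ Ioo (0:ℝ) 1, F (quantile μ u) = u := fun u hu => measureReal_Iic_quantile hu
  have hQJ : ∀ u ∈ Ioo (0:ℝ) 1, quantile μ u ∈ J := fun u hu =>
    quantile_mem_interior_setOf_pos hfd (convex_setOf_pos_of_mul_rpow_le hflc) hu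
  have hhF : ∀ y ∈ J, h (F y) = f y := by
    intro y hy
    have h1 : HasDerivAt (fun x => quantile μ (F x)) ((h (F y))⁻¹ * f y) y :=
      (hderiv _ (hF01 y hy)).comp y (hF y hy)
    have h2 : HasDerivAt (fun x => quantile μ (F x)) 1 y :=
      (hasDerivAt_id y).congr_of_eventuallyEq (by
        filter_upwards [hJ.mem_nhds hy] with z hz using hQF z hz)
    have h3 := h1.unique h2
    have h4 := (hpos _ (hF01 y hy)).ne'
    field_simp at h3
    exact h3.symm
  constructor
  · rintro ⟨s, hs⟩
    refine ⟨s.image F, fun u hu hus => ?_⟩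
    have hyJ := hQJ u hu
    obtain ⟨ε, hε, α, β, hαβ⟩ := hs (quantile μ u) hyJ fun hmem =>
      hus (Finset.mem_image.2 ⟨_, hmem, hFQ u hu⟩)
    obtain ⟨r, hr, hrJ⟩ := Metric.isOpen_iff.1 (hJ.inter Metric.isOpen_ball) (quantile μ u)
      ⟨hyJ, Metric.mem_ball_self hε⟩
    have hconst : ∀ z ∈ Metric.ball (quantile μ u) r,
        f z - β * F z = f (quantile μ u) - β * F (quantile μ u) := fun z hz => by
      refine eq_center_of_hasDerivAt_zero_on_ball (g := fun z => f z - β * F z)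
        (fun x hx => ?_) hz
      have hfx : HasDerivAt f (β * f x) x := by
        have h1 : HasDerivAt (fun z => Real.exp (α + β * z)) (Real.exp (α + β * x) * β) x := by
          simpa using (((hasDerivAt_id x).const_mul β).const_add α).exp
        rw [hαβ x (hrJ hx).2, mul_comm]
        refine h1.congr_of_eventuallyEq ?_
        filter_upwards [Metric.isOpen_ball.mem_nhds hx] with z hz using hαβ z (hrJ hz).2
      exact (hfx.sub ((hF x (hrJ hx).1).const_mul β)).congr_deriv (sub_self _)
    have hnear : ∀ᶠ v in nhds u, v ∈ Ioo (0:ℝ) 1 ∧ quantile μ v ∈ Metric.ball (quantile μ u) r :=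
      (isOpen_Ioo.eventually_mem hu).and
        ((hderiv u hu).continuousAt (Metric.ball_mem_nhds _ hr))
    obtain ⟨δ, hδ, hδv⟩ := Metric.eventually_nhds_iff.1 hnear
    refine ⟨δ, hδ, f (quantile μ u) - β * F (quantile μ u), β, fun v hv => ?_⟩
    obtain ⟨hv01, hvr⟩ := hδv hv
    have h1 := hconst _ hvr
    rw [← hhF _ (hQJ v hv01), hFQ v hv01] at h1
    linarith
  · rintro ⟨s, hs⟩
    refine ⟨s.image (quantile μ), fun y hy hys => ?_⟩
    obtain ⟨ε, hε, α, β, hαβ⟩ := hs (F y) (hF01 y hy) fun hmem =>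
      hys (Finset.mem_image.2 ⟨_, hmem, hQF y hy⟩)
    have hnear : ∀ᶠ z in nhds y, z ∈ J ∧ F z ∈ Metric.ball (F y) ε :=
      (hJ.eventually_mem hy).and
        ((hF y hy).continuousAt (Metric.ball_mem_nhds _ hε))
    obtain ⟨r, hr, hrz⟩ := Metric.eventually_nhds_iff_ball.1 hnear
    have hfF : ∀ z ∈ Metric.ball y r, f z = α + β * F z := fun z hz => by
      rw [← hhF z (hrz z hz).1]
      exact hαβ _ (hrz z hz).2
    refine ⟨r, hr, Real.log (f y) - β * y, β, fun z hz => ?_⟩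
    have hconst : f z * Real.exp (-(β * z)) = f y * Real.exp (-(β * y)) := by
      refine eq_center_of_hasDerivAt_zero_on_ball
        (g := fun z => f z * Real.exp (-(β * z))) (fun x hx => ?_) (r := r) hz
      have hfx : HasDerivAt f (β * f x) x := by
        refine (((hF x (hrz x hx).1).const_mul β).const_add α).congr_of_eventuallyEq ?_
        filter_upwards [Metric.isOpen_ball.mem_nhds hx] with z hz using hfF z hz
      have hexp : HasDerivAt (fun z => Real.exp (-(β * z))) (Real.exp (-(β * x)) * -β) x := by
        simpa using ((hasDerivAt_id x).const_mul β).neg.exp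
      refine (hfx.mul hexp).congr_deriv ?_
      ring
    calc f z = f z * Real.exp (-(β * z)) * Real.exp (β * z) := by
          rw [mul_assoc, ← Real.exp_add]; simp
      _ = Real.exp (Real.log (f y) - β * y + β * z) := by
          rw [hconst, Real.exp_add, sub_eq_add_neg, Real.exp_add, Real.exp_log (hfJ y hy)]
end
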